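/- arXiv:2306.07375 — 2 statements merged into one kernel-verified Lean document; each statement's English description precedes it below -/
import Mathlib

section
/- Let α ≤ 1, λ ∈ [0,1], f ∈ A with Re[α f(z)/z + (1-α) f'(z)] ≥ 1-λ on D \ {0}, and g ∈ A with Re(g(z)/z) > 1/2 on D \ {0}. Then the Hadamard product F = f * g satisfies Re[α F(z)/z + (1-α) F'(z)] ≥ 1-λ on D \ {0}. -/
open Metric Complex
open scoped ComplexConjugate

/-- Orthogonality of the characters `θ ↦ exp (k i θ)` on a full period. -/
lemma integral_exp_int_mul_I (k : ℤ) :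
    ∫ θ in (0 : ℝ)..2 * Real.pi, cexp (k * I * θ) = if k = 0 then 2 * (Real.pi : ℂ) else 0 := by
  split_ifs with hk
  · simp [hk]
  · have hc : (k : ℂ) * I ≠ 0 := mul_ne_zero (by exact_mod_cast hk) I_ne_zero
    rw [integral_exp_mul_complex hc]
    have : cexp (k * I * ((2 * Real.pi : ℝ) : ℂ)) = 1 := by
      rw [← exp_int_mul_two_pi_mul_I k]
      congr 1
      push_cast
      ring
    rw [this]
    simp

lemma norm_exp_int_mul_I_mul_ofReal (k : ℤ) (θ : ℝ) : ‖cexp (k * I * θ)‖ = 1 := by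
  have : (k : ℂ) * I * θ = ((k * θ : ℝ) : ℂ) * I := by push_cast; ring
  rw [this, norm_exp_ofReal_mul_I]

/-- An absolutely convergent trigonometric series may be integrated termwise against a
continuous function. -/
lemma hasSum_integral_trigSeries_mul {C : ℕ → ℂ} (hC : Summable fun n => ‖C n‖) (k : ℕ → ℤ)
    {P K : ℝ → ℂ} (hP : ∀ θ : ℝ, HasSum (fun n => C n * cexp (k n * I * θ)) (P θ))
    (hK : Continuous K) :
    HasSum (fun n => C n * ∫ θ in (0 : ℝ)..2 * Real.pi, cexp (k n * I * θ) * K θ)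
      (∫ θ in (0 : ℝ)..2 * Real.pi, P θ * K θ) := by
  simp_rw [← intervalIntegral.integral_const_mul, ← mul_assoc]
  refine intervalIntegral.hasSum_integral_of_dominated_convergence
    (fun n θ => ‖C n‖ * ‖K θ‖) (fun n => ?_) (fun n => ?_) ?_ ?_ ?_
  · exact Continuous.aestronglyMeasurable (by fun_prop)
  · refine Filter.Eventually.of_forall fun θ _ => ?_
    rw [norm_mul, norm_mul, norm_exp_int_mul_I_mul_ofReal, mul_one]
  · exact Filter.Eventually.of_forall fun θ _ => hC.mul_right _
  · simp_rw [tsum_mul_right]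
    exact Continuous.intervalIntegrable (by fun_prop) _ _
  · exact Filter.Eventually.of_forall fun θ _ => (hP θ).mul_right _

lemma continuous_of_hasSum_trigSeries {C : ℕ → ℂ} (hC : Summable fun n => ‖C n‖) (k : ℕ → ℤ)
    {P : ℝ → ℂ} (hP : ∀ θ : ℝ, HasSum (fun n => C n * cexp (k n * I * θ)) (P θ)) :
    Continuous P := by
  rw [show P = fun θ : ℝ => ∑' n, C n * cexp (k n * I * θ) from funext fun θ => (hP θ).tsum_eq.symm]
  refine continuous_tsum (fun n => by fun_prop) hC fun n θ => ?_
  rw [norm_mul, norm_exp_int_mul_I_mul_ofReal, mul_one]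

lemma hasSum_integral_exp_mul_trigSeries {D : ℕ → ℂ} (hD : Summable fun n => ‖D n‖)
    (k : ℕ → ℤ) {Q : ℝ → ℂ}
    (hQ : ∀ θ : ℝ, HasSum (fun n => D n * cexp (k n * I * θ)) (Q θ)) (l : ℤ) :
    HasSum (fun n => D n * if k n + l = 0 then 2 * (Real.pi : ℂ) else 0)
      (∫ θ in (0 : ℝ)..2 * Real.pi, cexp (l * I * θ) * Q θ) := by
  have h := hasSum_integral_trigSeries_mul hD k hQ
    (K := fun θ : ℝ => cexp (l * I * θ)) (by fun_prop)
  have hI (n : ℕ) : ∫ θ in (0 : ℝ)..2 * Real.pi, cexp (k n * I * θ) * cexp (l * I * θ) =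
      if k n + l = 0 then 2 * (Real.pi : ℂ) else 0 := by
    rw [← integral_exp_int_mul_I]
    congr 1 with θ
    rw [← Complex.exp_add]
    congr 1
    push_cast
    ring
  simpa only [hI, mul_comm (Q _)] using h

/-- If `Re P ≥ m` and `Re Q ≥ 1/2` on the unit circle, and `Q` has constant term `1`, then the
Hadamard product of `P` and `Q` at `1` has real part at least `m`. -/
lemma le_re_hadamard_of_trigSeries {C D : ℕ → ℂ} (hC : Summable fun n => ‖C n‖)
    (hD : Summable fun n => ‖D n‖) (hD0 : D 0 = 1) {P Q : ℝ → ℂ} {m : ℝ} {S : ℂ}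
    (hP : ∀ θ : ℝ, HasSum (fun n => C n * cexp ((n : ℤ) * I * θ)) (P θ))
    (hQ : ∀ θ : ℝ, HasSum (fun n => D n * cexp ((-n : ℤ) * I * θ)) (Q θ))
    (hPm : ∀ θ, m ≤ (P θ).re) (hQm : ∀ θ, 1 / 2 ≤ (Q θ).re)
    (hS : HasSum (fun n => C n * D n) S) : m ≤ S.re := by
  have hPc : Continuous P := continuous_of_hasSum_trigSeries hC (fun n => n) hP
  have hQc : Continuous Q := continuous_of_hasSum_trigSeries hD (fun n => -n) hQ
  have hQconj (θ : ℝ) : HasSum (fun n => conj (D n) * cexp ((n : ℤ) * I * θ)) (conj (Q θ)) := by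
    convert (hasSum_conj'.mpr (hQ θ)) using 2 with n
    simp [← Complex.exp_conj]
  set K : ℝ → ℂ := fun θ => Q θ + conj (Q θ) - 1 with hK
  have hconjc : Continuous fun θ => conj (Q θ) := Complex.continuous_conj.comp hQc
  have hKc : Continuous K := by fun_prop
  have hKre (θ : ℝ) : K θ = ((2 * (Q θ).re - 1 : ℝ) : ℂ) := by
    simp only [hK, Complex.add_conj]
    push_cast
    ring
  have hcoef (n : ℕ) :
      ∫ θ in (0 : ℝ)..2 * Real.pi, cexp ((n : ℤ) * I * θ) * K θ = 2 * Real.pi * D n := by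
    have h1 : ∫ θ in (0 : ℝ)..2 * Real.pi, cexp ((n : ℤ) * I * θ) * Q θ = 2 * Real.pi * D n := by
      refine (hasSum_integral_exp_mul_trigSeries hD (fun n => -n) hQ n).unique ?_
      convert hasSum_ite_eq n (2 * Real.pi * D n) using 2 with j
      by_cases hj : j = n
      · simp [hj, mul_comm]
      · have : ¬ (-(j : ℤ) + n = 0) := by omega
        simp [hj, this]
    have h2 : ∫ θ in (0 : ℝ)..2 * Real.pi, cexp ((n : ℤ) * I * θ) * conj (Q θ) =
        if (n : ℤ) = 0 then 2 * (Real.pi : ℂ) else 0 := by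
      refine (hasSum_integral_exp_mul_trigSeries (by simpa using hD) (fun n => n) hQconj n).unique ?_
      convert hasSum_ite_eq 0 (if (n : ℤ) = 0 then 2 * (Real.pi : ℂ) else 0) using 2 with j
      by_cases hj : j = 0
      · simp [hj, hD0]
      · have : ¬ ((j : ℤ) + n = 0) := by omega
        simp [hj, this]
    have hGint {G : ℝ → ℂ} (hG : Continuous G) : IntervalIntegrable
        (fun θ : ℝ => cexp ((n : ℤ) * I * θ) * G θ) MeasureTheory.volume 0 (2 * Real.pi) :=
      Continuous.intervalIntegrable (by fun_prop) _ _
    have h3 := integral_exp_int_mul_I n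
    simp only [hK, mul_sub, mul_add, mul_one]
    rw [intervalIntegral.integral_sub ((hGint hQc).add (hGint hconjc))
      (Continuous.intervalIntegrable (by fun_prop) _ _),
      intervalIntegral.integral_add (hGint hQc) (hGint hconjc), h1, h2, h3]
    ring
  have hPK : ∫ θ in (0 : ℝ)..2 * Real.pi, P θ * K θ = 2 * Real.pi * S := by
    refine (hasSum_integral_trigSeries_mul hC (fun n => n) hP hKc).unique ?_
    simp only [hcoef]
    convert! hS.mul_left (2 * (Real.pi : ℂ)) using 2 with n
    ring
  have hK0 : ∫ θ in (0 : ℝ)..2 * Real.pi, K θ = 2 * Real.pi := by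
    simpa [hD0] using hcoef 0
  have hPKre : ∫ θ in (0 : ℝ)..2 * Real.pi, (P θ).re * (2 * (Q θ).re - 1) = 2 * Real.pi * S.re := by
    have := reCLM.intervalIntegral_comp_comm (a := 0) (b := 2 * Real.pi)
      (μ := MeasureTheory.volume) (f := fun θ => P θ * K θ)
      (Continuous.intervalIntegrable (by fun_prop) _ _)
    rw [hPK] at this
    simpa [hKre, -ofReal_sub, -ofReal_mul] using this
  have hKint : ∫ θ in (0 : ℝ)..2 * Real.pi, (2 * (Q θ).re - 1) = 2 * Real.pi := by
    have : ((∫ θ in (0 : ℝ)..2 * Real.pi, (2 * (Q θ).re - 1) : ℝ) : ℂ) =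
        ((2 * Real.pi : ℝ) : ℂ) := by
      rw [← intervalIntegral.integral_ofReal]
      simp only [← hKre, hK0]
      push_cast
      rfl
    exact_mod_cast this
  have hmono : ∫ θ in (0 : ℝ)..2 * Real.pi, m * (2 * (Q θ).re - 1) ≤
      ∫ θ in (0 : ℝ)..2 * Real.pi, (P θ).re * (2 * (Q θ).re - 1) := by
    have hPre := Complex.continuous_re.comp hPc
    have hQre := Complex.continuous_re.comp hQc
    simp only [Function.comp_def] at hPre hQre
    refine intervalIntegral.integral_mono_on Real.two_pi_pos.le
      (Continuous.intervalIntegrable (by fun_prop) _ _)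
      (Continuous.intervalIntegrable (by fun_prop) _ _) fun θ _ => ?_
    exact mul_le_mul_of_nonneg_right (hPm θ) (by linarith [hQm θ])
  rw [intervalIntegral.integral_const_mul, hKint, hPKre, mul_comm] at hmono
  exact le_of_mul_le_mul_left hmono Real.two_pi_pos

/-- If `Re p ≥ m` and `Re q ≥ 1/2` on the punctured unit disc, where `q` has constant term `1`,
then the Hadamard product of `p` and `q` has real part at least `m` there. -/
lemma le_re_hadamard {c d : ℕ → ℂ} {p q : ℂ → ℂ} {m : ℝ} (hd0 : d 0 = 1)
    (hp : ∀ z ∈ ball (0 : ℂ) 1, z ≠ 0 → HasSum (fun n => c n * z ^ n) (p z))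
    (hq : ∀ z ∈ ball (0 : ℂ) 1, z ≠ 0 → HasSum (fun n => d n * z ^ n) (q z))
    (hpm : ∀ z ∈ ball (0 : ℂ) 1, z ≠ 0 → m ≤ (p z).re)
    (hqm : ∀ z ∈ ball (0 : ℂ) 1, z ≠ 0 → 1 / 2 ≤ (q z).re)
    {z S : ℂ} (hz : z ∈ ball (0 : ℂ) 1) (hz0 : z ≠ 0)
    (hS : HasSum (fun n => c n * d n * z ^ n) S) : m ≤ S.re := by
  have hz1 : ‖z‖ < 1 := by simpa using hz
  obtain ⟨r, hzr, hr1⟩ := exists_between hz1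
  have hr0 : 0 < r := (norm_nonneg z).trans_lt hzr
  have hrC : (r : ℂ) ≠ 0 := by exact_mod_cast hr0.ne'
  have hzrlt : ‖z / r‖ < 1 := by
    rw [norm_div, norm_real, Real.norm_of_nonneg hr0.le, div_lt_one hr0]
    exact hzr
  have hrlt : ‖(r : ℂ)‖ < 1 := by rwa [norm_real, Real.norm_of_nonneg hr0.le]
  have hzr0 : z / r ≠ 0 := div_ne_zero hz0 hrC
  have hmem {w : ℂ} (hw : ‖w‖ < 1) (k : ℤ) (θ : ℝ) : w * cexp (k * I * θ) ∈ ball (0 : ℂ) 1 := by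
    rwa [mem_ball_zero_iff, norm_mul, norm_exp_int_mul_I_mul_ofReal, mul_one]
  have hne {w : ℂ} (hw : w ≠ 0) (k : ℤ) (θ : ℝ) : w * cexp (k * I * θ) ≠ 0 :=
    mul_ne_zero hw (Complex.exp_ne_zero _)
  refine le_re_hadamard_of_trigSeries (C := fun n => c n * (z / r) ^ n) (D := fun n => d n * r ^ n)
    (P := fun θ => p (z / r * cexp ((1 : ℤ) * I * θ)))
    (Q := fun θ => q (r * cexp ((-1 : ℤ) * I * θ)))
    (hp _ (by simpa using hzrlt) hzr0).summable.norm
    (hq _ (by simpa using hrlt) hrC).summable.norm (by simpa using hd0)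
    (fun θ => ?_) (fun θ => ?_) (fun θ => hpm _ (hmem hzrlt _ _) (hne hzr0 _ _))
    (fun θ => hqm _ (hmem hrlt _ _) (hne hrC _ _)) ?_
  · convert hp _ (hmem hzrlt 1 θ) (hne hzr0 _ _) using 2 with n
    rw [mul_pow, ← Complex.exp_nat_mul, mul_assoc]
    congr 3
    push_cast
    ring
  · convert hq _ (hmem hrlt (-1) θ) (hne hrC _ _) using 2 with n
    rw [mul_pow, ← Complex.exp_nat_mul, mul_assoc]
    congr 3
    push_cast
    ring
  · convert hS using 2 with n
    rw [div_pow]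
    field_simp

/-- Termwise differentiation of a power series converging on the unit disc. -/
lemma hasSum_deriv_powerSeries {a : ℕ → ℂ} {f : ℂ → ℂ}
    (hf : ∀ z ∈ ball (0 : ℂ) 1, HasSum (fun n => a n * z ^ n) (f z)) {z : ℂ}
    (hz : z ∈ ball (0 : ℂ) 1) : HasSum (fun n => a n * (n * z ^ (n - 1))) (deriv f z) := by
  have hz1 : ‖z‖ < 1 := by simpa using hz
  obtain ⟨r, hzr, hr1⟩ := exists_between hz1
  have hr0 : 0 < r := (norm_nonneg z).trans_lt hzr
  have hr : (r : ℂ) ∈ ball (0 : ℂ) 1 := by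
    rwa [mem_ball_zero_iff, norm_real, Real.norm_of_nonneg hr0.le]
  have hzr' : z ∈ ball (0 : ℂ) r := by simpa using hzr
  have h := hasSum_deriv_of_summable_norm (F := fun n w => a n * w ^ n) (hf r hr).summable.norm
    (fun n => by fun_prop) isOpen_ball (fun n w hw => ?_) hzr'
  · have heq : (fun w => ∑' n, a n * w ^ n) =ᶠ[nhds z] f := by
      filter_upwards [isOpen_ball.mem_nhds hz] with w hw using (hf w hw).tsum_eq
    rw [heq.deriv_eq] at h
    simpa using h
  · rw [norm_mul, norm_mul, norm_pow, norm_pow, norm_real, Real.norm_of_nonneg hr0.le]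
    gcongr
    exact (by simpa using hw : ‖w‖ < r).le

lemma hasSum_div_powerSeries {a : ℕ → ℂ} (ha0 : a 0 = 0) {z s : ℂ} (hz0 : z ≠ 0)
    (h : HasSum (fun n => a n * z ^ n) s) : HasSum (fun n => a (n + 1) * z ^ n) (s / z) := by
  have h' := ((hasSum_nat_add_iff' 1).mpr h).div_const z
  simp only [Finset.range_one, Finset.sum_singleton, ha0, zero_mul, sub_zero] at h'
  convert! h' using 2 with n
  field_simp
  ring

lemma hasSum_generalizedClass {a : ℕ → ℂ} (ha0 : a 0 = 0) (α : ℂ) {f : ℂ → ℂ}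
    (hf : ∀ z ∈ ball (0 : ℂ) 1, HasSum (fun n => a n * z ^ n) (f z)) {z : ℂ}
    (hz : z ∈ ball (0 : ℂ) 1) (hz0 : z ≠ 0) :
    HasSum (fun n => (α + (1 - α) * (n + 1)) * a (n + 1) * z ^ n)
      (α * (f z / z) + (1 - α) * deriv f z) := by
  have h1 := hasSum_div_powerSeries ha0 hz0 (hf z hz)
  have h2 := (hasSum_nat_add_iff' 1).mpr (hasSum_deriv_powerSeries hf hz)
  simp only [Finset.range_one, Finset.sum_singleton, ha0, zero_mul, sub_zero] at h2
  convert! (h1.mul_left α).add (h2.mul_left (1 - α)) using 2 with n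
  simp only [Nat.add_sub_cancel]
  push_cast
  ring

/-- Hadamard products preserve the generalized analytic classes `𝔊_α^λ`: if
`f ∈ 𝔊_α^λ` (i.e. `Re (α f/z + (1-α) f') ≥ 1-λ`) and `g ∈ A` satisfies
`Re (g z / z) > 1/2`, then the Hadamard product `F = f * g` (coefficientwise product of
Taylor series) again satisfies `Re (α F/z + (1-α) F') ≥ 1-λ`. -/
theorem hadamard_preserves_generalized_analytic_class
    (α lam : ℝ) (hα : α ≤ 1) (hlam : lam ∈ Set.Icc (0:ℝ) 1)
    (a b : ℕ → ℂ) (f g F : ℂ → ℂ)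
    (hfdiff : DifferentiableOn ℂ f (ball (0:ℂ) 1))
    (hgdiff : DifferentiableOn ℂ g (ball (0:ℂ) 1))
    (hFdiff : DifferentiableOn ℂ F (ball (0:ℂ) 1))
    (ha0 : a 0 = 0) (ha1 : a 1 = 1) (hb0 : b 0 = 0) (hb1 : b 1 = 1)
    (hfrep : ∀ z ∈ ball (0:ℂ) 1, HasSum (fun n => a n * z ^ n) (f z))
    (hgrep : ∀ z ∈ ball (0:ℂ) 1, HasSum (fun n => b n * z ^ n) (g z))
    (hFrep : ∀ z ∈ ball (0:ℂ) 1, HasSum (fun n => a n * b n * z ^ n) (F z))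
    (hf : ∀ z ∈ ball (0:ℂ) 1, z ≠ 0 →
      1 - lam ≤ ((α : ℂ) * (f z / z) + (1 - (α:ℂ)) * deriv f z).re)
    (hg : ∀ z ∈ ball (0:ℂ) 1, z ≠ 0 → (1:ℝ)/2 < (g z / z).re) :
    ∀ z ∈ ball (0:ℂ) 1, z ≠ 0 →
      1 - lam ≤ ((α : ℂ) * (F z / z) + (1 - (α:ℂ)) * deriv F z).re := by
  intro z hz hz0
  refine le_re_hadamard (c := fun n => (α + (1 - α) * (n + 1)) * a (n + 1))
    (d := fun n => b (n + 1)) (p := fun z => α * (f z / z) + (1 - α) * deriv f z)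
    (q := fun z => g z / z) (by simpa using hb1)
    (fun w hw hw0 => hasSum_generalizedClass ha0 α hfrep hw hw0)
    (fun w hw hw0 => hasSum_div_powerSeries hb0 hw0 (hgrep w hw))
    hf (fun w hw hw0 => (hg w hw hw0).le) hz hz0 ?_
  convert hasSum_generalizedClass (a := fun n => a n * b n) (by simp [ha0]) (α : ℂ)
    hFrep hz hz0 using 2 with n
  ring
end

section
/- Let α, β ∈ ℝ with α + β < 2 and 5α + 4β < 6, and set μ = (2-α-β)/(6-5α-4β) > 0. Suppose f ∈ A with f(z)f'(z) ≠ 0 for z ∈ D\{0} and Re[α f(z)/z + β z f'(z)/f(z) + (1-α-β)(1 + z f''(z)/f'(z))] > (α+β)/2 on D\{0}. If f(z) = z + a₂z² + a₃z³ + ..., then |a₃ - λ a₂²| ≤ max{μ, |1-λ|} for every λ ∈ ℂ. -/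
open Metric Complex

/-- The numerator of a disk automorphism is dominated by its denominator on the closed disk. -/
lemma norm_sub_le_norm_one_sub_conj_mul {a w : ℂ} (ha : ‖a‖ ≤ 1) (hw : ‖w‖ ≤ 1) :
    ‖w - a‖ ≤ ‖1 - (starRingEnd ℂ) a * w‖ := by
  have ha' : a.re ^ 2 + a.im ^ 2 ≤ 1 := by
    have h := pow_le_one₀ (n := 2) (norm_nonneg a) ha
    rw [Complex.sq_norm, Complex.normSq_apply] at h
    linarith
  have hw' : w.re ^ 2 + w.im ^ 2 ≤ 1 := by
    have h := pow_le_one₀ (n := 2) (norm_nonneg w) hw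
    rw [Complex.sq_norm, Complex.normSq_apply] at h
    linarith
  refine le_of_pow_le_pow_left₀ two_ne_zero (norm_nonneg _) ?_
  simp only [Complex.sq_norm, Complex.normSq_apply, sub_re, sub_im, mul_re, mul_im, conj_re,
    conj_im, one_re, one_im]
  nlinarith [mul_nonneg (sub_nonneg.2 ha') (sub_nonneg.2 hw')]

/-- The **Schwarz–Pick lemma** at the origin. -/
lemma norm_deriv_zero_le_one_sub_sq {ψ : ℂ → ℂ} (hd : DifferentiableOn ℂ ψ (ball 0 1))
    (hb : ∀ z ∈ ball (0 : ℂ) 1, ‖ψ z‖ ≤ 1) : ‖deriv ψ 0‖ ≤ 1 - ‖ψ 0‖ ^ 2 := by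
  have h0 : (0 : ℂ) ∈ ball (0 : ℂ) 1 := mem_ball_self one_pos
  rcases (hb 0 h0).eq_or_lt with h | h
  · have hc : Set.EqOn ψ (Function.const ℂ (ψ 0)) (ball 0 1) :=
      Complex.eqOn_of_isPreconnected_of_isMaxOn_norm (convex_ball 0 1).isPreconnected
        isOpen_ball hd h0 (fun z hz => by simpa [h] using hb z hz)
    have := hc.deriv isOpen_ball h0
    rw [this, h, show deriv (Function.const ℂ (ψ 0)) 0 = 0 from deriv_const _ _]
    simp
  set a := ψ 0 with ha
  have hden : ∀ z ∈ ball (0 : ℂ) 1, 1 - (starRingEnd ℂ) a * ψ z ≠ 0 := by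
    intro z hz h1
    have h2 : ‖(starRingEnd ℂ) a * ψ z‖ = 1 := by rw [← sub_eq_zero.1 h1, norm_one]
    rw [norm_mul, RCLike.norm_conj] at h2
    nlinarith [hb z hz, norm_nonneg a, norm_nonneg (ψ z)]
  set M : ℂ → ℂ := fun z => (ψ z - a) / (1 - (starRingEnd ℂ) a * ψ z) with hM
  have hMd : DifferentiableOn ℂ M (ball 0 1) :=
    (hd.sub_const a).div ((hd.const_mul _).const_sub 1) hden
  have hM0 : M 0 = 0 := by simp [hM, ← ha]
  have hMb : Set.MapsTo M (ball 0 1) (closedBall (M 0) 1) := by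
    intro z hz
    rw [hM0, mem_closedBall_zero_iff, hM, norm_div]
    exact div_le_one_of_le₀ (norm_sub_le_norm_one_sub_conj_mul h.le (hb z hz)) (norm_nonneg _)
  have key := Complex.norm_deriv_le_one_of_mapsTo_ball hMd hMb one_pos
  have hψ : HasDerivAt ψ (deriv ψ 0) 0 :=
    (hd.differentiableAt (isOpen_ball.mem_nhds h0)).hasDerivAt
  have hpos : 0 < 1 - ‖a‖ ^ 2 := by nlinarith [norm_nonneg a]
  have hden0 : 1 - (starRingEnd ℂ) a * a = ((1 - ‖a‖ ^ 2 : ℝ) : ℂ) := by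
    rw [Complex.conj_mul']; push_cast; rfl
  have hMder : deriv M 0 = deriv ψ 0 / ((1 - ‖a‖ ^ 2 : ℝ) : ℂ) := by
    have h1 := ((hψ.sub_const a).div ((hψ.const_mul ((starRingEnd ℂ) a)).const_sub 1)
      (hden 0 h0)).deriv
    have h2 : ((1 - ‖a‖ ^ 2 : ℝ) : ℂ) ≠ 0 := by exact_mod_cast hpos.ne'
    refine h1.trans ?_
    rw [← ha, hden0]
    field_simp
    ring
  rw [hMder, norm_div, Complex.norm_real, Real.norm_of_nonneg hpos.le, div_le_one hpos] at key
  exact key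

/-- If `1 + z k(z)` maps the unit disk to the half-plane `Re > 1 - c / 2`, the first two
coefficients of the associated Schwarz function satisfy the Schwarz–Pick bound. -/
lemma norm_coeff_le_of_re_mul_gt {k : ℂ → ℂ} {c : ℝ} (hc : 0 < c)
    (hk : DifferentiableOn ℂ k (ball 0 1))
    (hre : ∀ z ∈ ball (0 : ℂ) 1, -(c / 2) < (z * k z).re) :
    ‖deriv k 0 / c - (k 0 / c) ^ 2‖ ≤ 1 - ‖k 0 / c‖ ^ 2 := by
  have h0 : (0 : ℂ) ∈ ball (0 : ℂ) 1 := mem_ball_self one_pos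
  have hlt : ∀ z ∈ ball (0 : ℂ) 1, ‖z * k z‖ < ‖(c : ℂ) + z * k z‖ := by
    intro z hz
    apply lt_of_pow_lt_pow_left₀ 2 (norm_nonneg _)
    simp only [Complex.sq_norm, Complex.normSq_apply, add_re, add_im, ofReal_re, ofReal_im]
    nlinarith [mul_pos hc (by linarith [hre z hz] : 0 < c / 2 + (z * k z).re)]
  have hden : ∀ z ∈ ball (0 : ℂ) 1, (c : ℂ) + z * k z ≠ 0 := fun z hz =>
    norm_pos_iff.1 ((norm_nonneg _).trans_lt (hlt z hz))
  set ψ : ℂ → ℂ := fun z => k z / (c + z * k z) with hψ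
  have hψd : DifferentiableOn ℂ ψ (ball 0 1) :=
    hk.div ((differentiableOn_id.mul hk).const_add _) hden
  have hψb : ∀ z ∈ ball (0 : ℂ) 1, ‖ψ z‖ ≤ 1 := by
    set ω : ℂ → ℂ := fun z => z * ψ z with hω
    have hω0 : ω 0 = 0 := by simp [hω]
    have hωb : Set.MapsTo ω (ball 0 1) (closedBall (ω 0) 1) := by
      intro z hz
      rw [hω0, mem_closedBall_zero_iff]
      simp only [hω, hψ]
      rw [← mul_div_assoc, norm_div]
      exact div_le_one_of_le₀ (hlt z hz).le (norm_nonneg _)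
    have hωd : DifferentiableOn ℂ ω (ball 0 1) := differentiableOn_id.mul hψd
    intro z hz
    have h1 := Complex.norm_dslope_le_div_of_mapsTo_ball hωd hωb hz
    rw [div_one] at h1
    rcases eq_or_ne z 0 with rfl | hz0
    · rw [dslope_same] at h1
      have h2 : deriv ω 0 = ψ 0 := by
        have := ((hasDerivAt_id (0 : ℂ)).mul
          (hψd.differentiableAt (isOpen_ball.mem_nhds h0)).hasDerivAt).deriv
        exact this.trans (by simp)
      rwa [h2] at h1
    · rw [dslope_of_ne _ hz0, slope_def_field, hω0] at h1
      simpa [hω, hz0] using h1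
  have key := norm_deriv_zero_le_one_sub_sq hψd hψb
  have hcc : (c : ℂ) ≠ 0 := by exact_mod_cast hc.ne'
  have hkd : HasDerivAt k (deriv k 0) 0 :=
    (hk.differentiableAt (isOpen_ball.mem_nhds h0)).hasDerivAt
  have hder : deriv ψ 0 = deriv k 0 / c - (k 0 / c) ^ 2 := by
    refine (hkd.div (((hasDerivAt_id (0 : ℂ)).mul hkd).const_add (c : ℂ)) ?_).deriv.trans ?_
    · simpa using hcc
    · simp
      field_simp
  have hψ0 : ψ 0 = k 0 / c := by simp [hψ]
  rwa [hder, hψ0] at key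

/-- A holomorphic function on the unit disk factors as `h 0 + z g(z)`. -/
lemma exists_eq_add_id_mul {h : ℂ → ℂ} (hd : DifferentiableOn ℂ h (ball 0 1)) :
    ∃ g : ℂ → ℂ, DifferentiableOn ℂ g (ball 0 1) ∧ ∀ z, h z = h 0 + z * g z := by
  refine ⟨dslope h 0, (Complex.differentiableOn_dslope (ball_mem_nhds _ one_pos)).2 hd, ?_⟩
  intro z
  have := sub_smul_dslope h 0 z
  simp only [sub_zero, smul_eq_mul] at this
  rw [this]; ring

lemma deriv_eq_of_eqOn_add_id_mul {h p g : ℂ → ℂ} (hp : DifferentiableOn ℂ p (ball 0 1))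
    (hg : DifferentiableOn ℂ g (ball 0 1)) (heq : ∀ z ∈ ball (0 : ℂ) 1, h z = p z + z * g z) :
    ∀ z ∈ ball (0 : ℂ) 1, deriv h z = (deriv p z + g z) + z * deriv g z := by
  intro z hz
  have h1 : Set.EqOn h (fun z => p z + z * g z) (ball 0 1) := heq
  rw [h1.deriv isOpen_ball hz]
  have hn := isOpen_ball.mem_nhds hz
  refine ((hp.differentiableAt hn).hasDerivAt.add
    ((hasDerivAt_id z).mul (hg.differentiableAt hn).hasDerivAt)).deriv.trans ?_
  simp
  ring

/-- Combining the Schwarz–Pick coefficient bound `‖B‖ ≤ 1 - ‖A‖ ^ 2` with weights. -/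
lemma norm_mul_add_mul_sq_le_max {A B s : ℂ} {m : ℝ} (hm : 0 ≤ m) (hAB : ‖B‖ ≤ 1 - ‖A‖ ^ 2) :
    ‖(m : ℂ) * B + s * A ^ 2‖ ≤ max m ‖s‖ := by
  refine (norm_add_le _ _).trans ?_
  rw [norm_mul, norm_mul, norm_pow, Complex.norm_real, Real.norm_of_nonneg hm]
  nlinarith [le_max_left m ‖s‖, le_max_right m ‖s‖, norm_nonneg B, sq_nonneg ‖A‖,
    mul_le_mul_of_nonneg_left hAB hm,
    mul_nonneg (sub_nonneg.2 (le_max_left m ‖s‖)) ((norm_nonneg B).trans hAB),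
    mul_nonneg (sub_nonneg.2 (le_max_right m ‖s‖)) (sq_nonneg ‖A‖)]

/-- Fekete–Szegő estimate over the classes `M_{α,β}`: if `α+β < 2`, `5α+4β < 6`,
`μ = (2-α-β)/(6-5α-4β)`, `f ∈ A` with `f z · f' z ≠ 0` on the punctured disk and
`Re [α f/z + β z f'/f + (1-α-β)(1 + z f''/f')] > (α+β)/2` there, then writing
`f z = z + a₂ z² + a₃ z³ + ⋯` one has `|a₃ - λ a₂²| ≤ max {μ, |1-λ|}` for all `λ ∈ ℂ`. -/
theorem fekete_szego_M_class
    (α β : ℝ) (h1 : α + β < 2) (h2 : 5*α + 4*β < 6)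
    (f : ℂ → ℂ) (hf : DifferentiableOn ℂ f (ball (0:ℂ) 1))
    (hf0 : f 0 = 0) (hf1 : deriv f 0 = 1)
    (hne : ∀ z ∈ ball (0:ℂ) 1, z ≠ 0 → f z * deriv f z ≠ 0)
    (hre : ∀ z ∈ ball (0:ℂ) 1, z ≠ 0 →
      (α + β) / 2 <
        ((α : ℂ) * (f z / z) + (β : ℂ) * (z * deriv f z / f z) +
          (1 - (α:ℂ) - (β:ℂ)) * (1 + z * iteratedDeriv 2 f z / deriv f z)).re) :
    ∀ lam : ℂ,
      ‖iteratedDeriv 3 f 0 / 6 - lam * (iteratedDeriv 2 f 0 / 2) ^ 2‖ ≤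
        max ((2 - α - β) / (6 - 5*α - 4*β)) ‖1 - lam‖ := by
  have h0 : (0 : ℂ) ∈ ball (0 : ℂ) 1 := mem_ball_self one_pos
  obtain ⟨φ, hφ, hfφ⟩ := exists_eq_add_id_mul hf
  simp only [hf0, zero_add] at hfφ
  obtain ⟨χ, hχ, hφχ⟩ := exists_eq_add_id_mul hφ
  have hφ' := hφ.deriv isOpen_ball
  have hφ'' := hφ'.deriv isOpen_ball
  have hf' := hf.deriv isOpen_ball
  have hf'' := hf'.deriv isOpen_ball
  have hχ' := hχ.deriv isOpen_ball
  have e1 : ∀ z ∈ ball (0 : ℂ) 1, deriv f z = φ z + z * deriv φ z := by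
    simpa using deriv_eq_of_eqOn_add_id_mul (h := f) (differentiableOn_const 0) hφ
      (by simpa using fun z _ => hfφ z)
  have e2 : ∀ z ∈ ball (0 : ℂ) 1,
      deriv (deriv f) z = (deriv φ z + deriv φ z) + z * deriv (deriv φ) z :=
    deriv_eq_of_eqOn_add_id_mul hφ hφ' e1
  have e3 := deriv_eq_of_eqOn_add_id_mul (hφ'.add hφ') hφ'' e2 0 h0
  have d1 : ∀ z ∈ ball (0 : ℂ) 1, deriv φ z = χ z + z * deriv χ z := by
    simpa using deriv_eq_of_eqOn_add_id_mul (differentiableOn_const (φ 0)) hχ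
      (fun z _ => hφχ z)
  have d2 := deriv_eq_of_eqOn_add_id_mul hχ hχ' d1 0 h0
  have hφ0 : φ 0 = 1 := by simpa [hf1] using (e1 0 h0).symm
  have dφ0 : HasDerivAt φ (deriv φ 0) 0 :=
    (hφ.differentiableAt (isOpen_ball.mem_nhds h0)).hasDerivAt
  have dφ'0 : HasDerivAt (deriv φ) (deriv (deriv φ) 0) 0 :=
    (hφ'.differentiableAt (isOpen_ball.mem_nhds h0)).hasDerivAt
  have df'0 : HasDerivAt (deriv f) (deriv (deriv f) 0) 0 :=
    (hf'.differentiableAt (isOpen_ball.mem_nhds h0)).hasDerivAt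
  have df''0 : HasDerivAt (deriv (deriv f)) (deriv (deriv (deriv f)) 0) 0 :=
    (hf''.differentiableAt (isOpen_ball.mem_nhds h0)).hasDerivAt
  have dχ0 : HasDerivAt χ (deriv χ 0) 0 :=
    (hχ.differentiableAt (isOpen_ball.mem_nhds h0)).hasDerivAt
  have e3' : deriv (deriv (deriv f)) 0 = 3 * deriv (deriv φ) 0 := by
    rw [e3, (dφ'0.add dφ'0).deriv]; ring
  have e2' : deriv (deriv f) 0 = 2 * deriv φ 0 := by rw [e2 0 h0]; ring
  have d1' : deriv φ 0 = χ 0 := by rw [d1 0 h0]; ring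
  have d2' : deriv (deriv φ) 0 = 2 * deriv χ 0 := by rw [d2]; ring
  have i2 : iteratedDeriv 2 f = deriv (deriv f) := by
    rw [iteratedDeriv_succ, iteratedDeriv_one]
  have i3 : iteratedDeriv 3 f = deriv (deriv (deriv f)) := by
    rw [iteratedDeriv_succ, i2]
  have hφne : ∀ z ∈ ball (0 : ℂ) 1, φ z ≠ 0 := by
    intro z hz h
    rcases eq_or_ne z 0 with rfl | hz0
    · exact one_ne_zero (hφ0.symm.trans h)
    · exact hne z hz hz0 (by rw [hfφ z, h]; ring)
  have hf'ne : ∀ z ∈ ball (0 : ℂ) 1, deriv f z ≠ 0 := by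
    intro z hz h
    rcases eq_or_ne z 0 with rfl | hz0
    · exact one_ne_zero (hf1.symm.trans h)
    · exact hne z hz hz0 (by rw [h]; ring)
  set k : ℂ → ℂ := fun z => (α : ℂ) * χ z + (β : ℂ) * (deriv φ z / φ z) +
    (1 - (α : ℂ) - (β : ℂ)) * (deriv (deriv f) z / deriv f z) with hk
  have hkd : DifferentiableOn ℂ k (ball 0 1) :=
    ((hχ.const_mul _).add ((hφ'.div hφ hφne).const_mul _)).add
      ((hf''.div hf' hf'ne).const_mul _)
  have hc : 0 < 2 - α - β := by linarith
  have hkre : ∀ z ∈ ball (0 : ℂ) 1, -((2 - α - β) / 2) < (z * k z).re := by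
    intro z hz
    rcases eq_or_ne z 0 with rfl | hz0
    · simpa using hc
    have h3 := hre z hz hz0
    have h4 : (α : ℂ) * (f z / z) + (β : ℂ) * (z * deriv f z / f z) +
        (1 - (α : ℂ) - (β : ℂ)) * (1 + z * iteratedDeriv 2 f z / deriv f z) = 1 + z * k z := by
      have q1 : f z / z = 1 + z * χ z := by
        rw [hfφ z, mul_div_cancel_left₀ _ hz0, hφχ z, hφ0]
      have q2 : z * deriv f z / f z = 1 + z * (deriv φ z / φ z) := by
        have := hφne z hz
        rw [hfφ z, e1 z hz]
        field_simp
      rw [q1, q2, i2, hk]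
      ring
    rw [h4, add_re, one_re] at h3
    linarith
  have key := norm_coeff_le_of_re_mul_gt hc hkd hkre
  have hk0 : k 0 = ((2 - α - β : ℝ) : ℂ) * χ 0 := by
    simp only [hk, hφ0, hf1, e2', d1']
    push_cast
    ring
  have hdk : deriv k 0 = ((6 - 5 * α - 4 * β : ℝ) : ℂ) * deriv χ 0 +
      (((2 - α - β : ℝ) : ℂ) - ((6 - 5 * α - 4 * β : ℝ) : ℂ)) * χ 0 ^ 2 := by
    refine (((dχ0.const_mul (α : ℂ)).add ((dφ'0.div dφ0 (hφne 0 h0)).const_mul (β : ℂ))).add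
      ((df''0.div df'0 (hf'ne 0 h0)).const_mul
        (1 - (α : ℂ) - (β : ℂ)))).deriv.trans ?_
    simp only [hφ0, hf1, e3', e2', d1', d2']
    push_cast
    ring
  have hD : 0 < 6 - 5 * α - 4 * β := by linarith
  have hcc : ((2 - α - β : ℝ) : ℂ) ≠ 0 := by exact_mod_cast hc.ne'
  have hDc : ((6 - 5 * α - 4 * β : ℝ) : ℂ) ≠ 0 := by exact_mod_cast hD.ne'
  have hA : k 0 / ((2 - α - β : ℝ) : ℂ) = χ 0 := by rw [hk0, mul_div_cancel_left₀ _ hcc]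
  rw [hA, hdk] at key
  intro lam
  have hfin := norm_mul_add_mul_sq_le_max (s := 1 - lam) (div_nonneg hc.le hD.le) key
  convert hfin using 2
  rw [i2, i3, e3', e2', d2', d1', Complex.ofReal_div]
  generalize ((2 - α - β : ℝ) : ℂ) = c at hcc ⊢
  generalize ((6 - 5 * α - 4 * β : ℝ) : ℂ) = d at hDc ⊢
  field_simp
  ring
end
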